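/- arXiv:math/0511189 — 2 statements merged into one kernel-verified Lean document; each statement's English description precedes it below -/
import Mathlib

section
/- For every n ≥ 1 there is a unique polynomial C_n ∈ ℤ[z] such that substituting z = s − s⁻¹ yields C_n(s − s⁻¹) = (1 + (1 − s²)ⁿ)(1 + (1 − s⁻²)ⁿ) in ℤ[s, s⁻¹]. Moreover: the constant coefficient of C_n equals 1; the coefficient of z^j in C_n is 0 for every j with 1 ≤ j ≤ n−1; if n is even then the coefficient of zⁿ in C_n equals 2; and if n is odd then the coefficient of zⁿ in C_n equals 0 and, provided n ≥ 3, the coefficient of z^{n+1} in C_n equals −n. -/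
open LaurentPolynomial

/-- The polynomial expression in `z = s - s⁻¹` of the power sum `(1 - s²)ⁿ + (1 - s⁻²)ⁿ`. -/
noncomputable def wheelPowerSum : ℕ → Polynomial ℤ
  | 0 => 2
  | 1 => -Polynomial.X ^ 2
  | n + 2 => Polynomial.X ^ 2 * (wheelPowerSum n - wheelPowerSum (n + 1))

/-- The Conway polynomial of the wheel clasper knot with `n` legs. -/
noncomputable def wheelConway (n : ℕ) : Polynomial ℤ :=
  1 + wheelPowerSum n + (-Polynomial.X ^ 2) ^ n

lemma T_two_eq_sq : (T 2 : LaurentPolynomial ℤ) = T 1 ^ 2 := by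
  simp [T_pow]

lemma T_neg_two_eq_sq : (T (-2) : LaurentPolynomial ℤ) = T (-1) ^ 2 := by
  simp [T_pow]

lemma T_one_mul_T_neg_one : (T 1 * T (-1) : LaurentPolynomial ℤ) = 1 := by
  rw [← T_add, add_neg_cancel, T_zero]

lemma one_sub_T_two_mul :
    ((1 - T 2) * (1 - T (-2)) : LaurentPolynomial ℤ) = -(T 1 - T (-1)) ^ 2 := by
  rw [T_two_eq_sq, T_neg_two_eq_sq]
  linear_combination (T 1 * T (-1) - 1 : LaurentPolynomial ℤ) * T_one_mul_T_neg_one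

lemma one_sub_T_two_add :
    ((1 - T 2) + (1 - T (-2)) : LaurentPolynomial ℤ) = -(T 1 - T (-1)) ^ 2 := by
  rw [T_two_eq_sq, T_neg_two_eq_sq]
  linear_combination (-2 : LaurentPolynomial ℤ) * T_one_mul_T_neg_one

lemma aeval_wheelPowerSum (n : ℕ) :
    Polynomial.aeval (T 1 - T (-1) : LaurentPolynomial ℤ) (wheelPowerSum n) =
      (1 - T 2) ^ n + (1 - T (-2)) ^ n := by
  induction n using Nat.twoStepInduction with
  | zero => rw [wheelPowerSum, map_ofNat]; norm_num
  | one => simpa [wheelPowerSum] using one_sub_T_two_add.symm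
  | more n ih₀ ih₁ =>
    simp only [wheelPowerSum, map_mul, map_sub, map_pow, Polynomial.aeval_X, ih₀, ih₁]
    linear_combination
      ((1 - T 2) ^ n + (1 - T (-2)) ^ n : LaurentPolynomial ℤ) * one_sub_T_two_mul -
      ((1 - T 2) ^ (n + 1) + (1 - T (-2)) ^ (n + 1) : LaurentPolynomial ℤ) * one_sub_T_two_add

lemma aeval_wheelConway (n : ℕ) :
    Polynomial.aeval (T 1 - T (-1) : LaurentPolynomial ℤ) (wheelConway n) =
      (1 + (1 - T 2) ^ n) * (1 + (1 - T (-2)) ^ n) := by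
  simp only [wheelConway, map_add, map_one, map_pow, map_neg, Polynomial.aeval_X,
    aeval_wheelPowerSum, ← one_sub_T_two_mul, mul_pow]
  ring

lemma aeval_T_one_sub_T_neg_one_injective :
    Function.Injective (Polynomial.aeval (R := ℤ) (T 1 - T (-1) : LaurentPolynomial ℤ)) := by
  intro p q h
  apply Polynomial.map_injective (Int.castRingHom ℝ) Int.cast_injective
  refine Polynomial.funext fun x => ?_
  let u : ℝˣ := Units.mk0 (Real.exp (Real.arsinh (x / 2))) (Real.exp_ne_zero _)
  let φ := LaurentPolynomial.eval₂ (Int.castRingHom ℝ) u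
  have hφ : φ (T 1 - T (-1)) = x := by
    have hx := Real.sinh_arsinh (x / 2)
    rw [Real.sinh_eq, Real.exp_neg] at hx
    simp only [φ, u, map_sub, eval₂_T, zpow_one, zpow_neg, Units.val_inv_eq_inv_val,
      Units.val_mk0]
    linarith
  have key (r : Polynomial ℤ) : (r.map (Int.castRingHom ℝ)).eval x =
      φ (Polynomial.aeval (T 1 - T (-1)) r) := by
    rw [Polynomial.aeval_def, Polynomial.hom_eval₂, hφ, Polynomial.eval_map]
    congr 1
    exact RingHom.ext_int _ _
  rw [key, key, h]

lemma wheelPowerSum_lowest_terms (m : ℕ) :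
    (∃ q, wheelPowerSum (2 * m) =
      Polynomial.X ^ (2 * m) * (Polynomial.C 2 + Polynomial.X * q)) ∧
    ∃ r, wheelPowerSum (2 * m + 1) =
      Polynomial.X ^ (2 * m + 2) * (Polynomial.C (-(2 * m + 1 : ℤ)) + Polynomial.X * r) := by
  induction m with
  | zero => exact ⟨⟨0, by simp [wheelPowerSum]⟩, ⟨0, by simp [wheelPowerSum]⟩⟩
  | succ m ih =>
    obtain ⟨⟨q, hq⟩, r, hr⟩ := ih
    have he : wheelPowerSum (2 * (m + 1)) = Polynomial.X ^ (2 * (m + 1)) * (Polynomial.C 2 +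
        Polynomial.X * (q - Polynomial.X *
          (Polynomial.C (-(2 * m + 1 : ℤ)) + Polynomial.X * r))) := by
      rw [show 2 * (m + 1) = 2 * m + 2 by ring, wheelPowerSum, hq, hr]
      ring
    refine ⟨⟨_, he⟩, r - (q - Polynomial.X *
      (Polynomial.C (-(2 * m + 1 : ℤ)) + Polynomial.X * r)), ?_⟩
    rw [show 2 * (m + 1) + 1 = 2 * m + 1 + 2 by ring, wheelPowerSum, hr,
      show 2 * m + 1 + 1 = 2 * (m + 1) by ring, he]
    simp only [map_neg, map_add, map_mul, map_one, map_natCast, map_ofNat, Nat.cast_add,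
      Nat.cast_one]
    ring

lemma coeff_wheelConway (n j : ℕ) (hj : j < 2 * n) :
    (wheelConway n).coeff j = (if j = 0 then 1 else 0) + (wheelPowerSum n).coeff j := by
  have h : ((-Polynomial.X ^ 2) ^ n : Polynomial ℤ).coeff j = 0 := by
    rw [neg_pow, ← pow_mul, mul_comm, Polynomial.coeff_X_pow_mul', if_neg (by omega)]
  simp [wheelConway, h, Polynomial.coeff_one]

/-- For every `n ≥ 1` there is a unique polynomial `C ∈ ℤ[z]` with
`C(s − s⁻¹) = (1 + (1 − s²)ⁿ)(1 + (1 − s⁻²)ⁿ)` in `ℤ[s, s⁻¹]` (with `T k` denoting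
`s^k`).  Moreover any such `C` has constant coefficient `1`, vanishing coefficients in
degrees `1, …, n−1`, coefficient of `zⁿ` equal to `2` if `n` is even, and, if `n` is
odd, coefficient of `zⁿ` equal to `0` and (for `n ≥ 3`) coefficient of `z^(n+1)` equal
to `−n`. -/
theorem conway_poly_wheel (n : ℕ) (hn : 1 ≤ n) :
    (∃! C : Polynomial ℤ,
        Polynomial.aeval (T 1 - T (-1) : LaurentPolynomial ℤ) C =
          (1 + (1 - T 2) ^ n) * (1 + (1 - T (-2)) ^ n)) ∧
      ∀ C : Polynomial ℤ,
        Polynomial.aeval (T 1 - T (-1) : LaurentPolynomial ℤ) C =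
            (1 + (1 - T 2) ^ n) * (1 + (1 - T (-2)) ^ n) →
          C.coeff 0 = 1 ∧
          (∀ j, 1 ≤ j → j ≤ n - 1 → C.coeff j = 0) ∧
          (Even n → C.coeff n = 2) ∧
          (Odd n → C.coeff n = 0 ∧ (3 ≤ n → C.coeff (n + 1) = -(n : ℤ))) := by
  have unique (C : Polynomial ℤ) (hC : Polynomial.aeval (T 1 - T (-1) : LaurentPolynomial ℤ) C =
      (1 + (1 - T 2) ^ n) * (1 + (1 - T (-2)) ^ n)) : C = wheelConway n :=
    aeval_T_one_sub_T_neg_one_injective (hC.trans (aeval_wheelConway n).symm)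
  refine ⟨⟨wheelConway n, aeval_wheelConway n, unique⟩, fun C hC => ?_⟩
  obtain rfl := unique C hC
  obtain ⟨m, rfl | rfl⟩ := n.even_or_odd'
  · obtain ⟨⟨q, hq⟩, -⟩ := wheelPowerSum_lowest_terms m
    have low (j : ℕ) (hj : j < 2 * m) : (wheelPowerSum (2 * m)).coeff j = 0 := by
      rw [hq, Polynomial.coeff_X_pow_mul', if_neg (by omega)]
    refine ⟨?_, fun j h₁ h₂ => ?_, fun _ => ?_, fun h => ?_⟩
    · rw [coeff_wheelConway _ _ (by omega), low _ (by omega)]; simp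
    · rw [coeff_wheelConway _ _ (by omega), low _ (by omega), if_neg (by omega), add_zero]
    · rw [coeff_wheelConway _ _ (by omega), hq, if_neg (by omega), Polynomial.coeff_X_pow_mul']
      simp
    · exact absurd (even_two_mul m) (Nat.not_even_iff_odd.mpr h)
  · obtain ⟨-, r, hr⟩ := wheelPowerSum_lowest_terms m
    have low (j : ℕ) (hj : j < 2 * m + 2) : (wheelPowerSum (2 * m + 1)).coeff j = 0 := by
      rw [hr, Polynomial.coeff_X_pow_mul', if_neg (by omega)]
    refine ⟨?_, fun j h₁ h₂ => ?_, fun h => ?_, fun _ => ⟨?_, fun h₃ => ?_⟩⟩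
    · rw [coeff_wheelConway _ _ (by omega), low _ (by omega)]; simp
    · rw [coeff_wheelConway _ _ (by omega), low _ (by omega), if_neg (by omega), add_zero]
    · exact absurd h (Nat.not_even_iff_odd.mpr (odd_two_mul_add_one m))
    · rw [coeff_wheelConway _ _ (by omega), low _ (by omega), if_neg (by omega), add_zero]
    · rw [coeff_wheelConway _ _ (by omega), hr, if_neg (by omega), Polynomial.coeff_X_pow_mul']
      simp
end

section
/- Let V be a finite set, let E be a graph on V, and let D be a set of unordered pairs of distinct elements of V such that D is the edge set of a Hamiltonian cycle on V (i.e. (V, D) is connected and every vertex has degree 2 in (V, D)) and D ∩ E = ∅. Then Σ_{S ⊆ D} h(V, E ∪ S) ≡ 1 (mod 2), where the sum is over all subsets S of D. -/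
open scoped Classical

variable {V : Type*}

/-- The degree of the vertex `v` in the graph on `V` whose edge set is the finite set
`C` of unordered pairs: the number of edges of `C` containing `v`. -/
noncomputable def edgeDegree (C : Finset (Sym2 V)) (v : V) : ℕ :=
  (C.filter fun e => v ∈ e).card

/-- `C` is the edge set of a Hamiltonian cycle on the (whole) vertex set `V`:
its edges are unordered pairs of distinct vertices, every vertex of `V` has degree
exactly `2` in `(V, C)`, and the graph `(V, C)` is connected. -/
def IsHamiltonianCycleOn [Fintype V] (C : Finset (Sym2 V)) : Prop :=
  (∀ e ∈ C, ¬ e.IsDiag) ∧ (∀ v : V, edgeDegree C v = 2) ∧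
    (SimpleGraph.fromEdgeSet (↑C : Set (Sym2 V))).Connected

/-- `hamCount E` is the number of Hamiltonian cycles of the graph on `V` with edge set
`E`, i.e. the number of subsets `C ⊆ E` which are edge sets of Hamiltonian cycles. -/
noncomputable def hamCount [Fintype V] (E : Finset (Sym2 V)) : ℕ :=
  (E.powerset.filter fun C => IsHamiltonianCycleOn C).card

/-- A Hamiltonian cycle contains no other Hamiltonian cycle. -/
theorem IsHamiltonianCycleOn.eq_of_subset [Fintype V] {C D : Finset (Sym2 V)}
    (hD : IsHamiltonianCycleOn D) (hC : IsHamiltonianCycleOn C) (hDC : D ⊆ C) : C = D := by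
  refine (Finset.Subset.antisymm hDC fun e he => ?_).symm
  obtain ⟨v, hv⟩ : ∃ v, v ∈ e := ⟨_, e.out_fst_mem⟩
  have hfilter : (D.filter fun e => v ∈ e) = C.filter fun e => v ∈ e :=
    Finset.eq_of_subset_of_card_le (Finset.filter_subset_filter _ hDC)
      ((hC.2.1 v).trans (hD.2.1 v).symm).le
  exact (Finset.mem_filter.mp (hfilter ▸ Finset.mem_filter.mpr ⟨he, hv⟩)).1

/-- The number of subsets `S` of `D` such that `E ∪ S` contains `C` is even, unless
`C` contains `D`. -/
theorem even_card_filter_subset_union {α : Type*} [DecidableEq α] {C D E : Finset α}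
    (hC : C ⊆ E ∪ D) (hDC : ¬ D ⊆ C) :
    Even (D.powerset.filter fun S => C ⊆ E ∪ S).card := by
  have hsub : C \ E ⊆ D := sdiff_le_iff.mpr hC
  have hIcc : (D.powerset.filter fun S => C ⊆ E ∪ S) = Finset.Icc (C \ E) D := by
    ext S
    simp only [Finset.mem_filter, Finset.mem_powerset, Finset.mem_Icc, sdiff_le_iff]
    exact and_comm
  have hlt : (C \ E).card < D.card :=
    Finset.card_lt_card ⟨hsub, fun h => hDC (h.trans Finset.sdiff_subset)⟩
  rw [hIcc, Finset.card_Icc_finset hsub]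
  exact even_two.pow_of_ne_zero (Nat.sub_pos_of_lt hlt).ne'

/-- Let `E` be a graph on a finite vertex set `V` (a finite set of unordered pairs of
distinct vertices) and let `D` be the edge set of a Hamiltonian cycle on `V` with
`D ∩ E = ∅`.  Then `Σ_{S ⊆ D} h(V, E ∪ S) ≡ 1 (mod 2)`, where `h` counts Hamiltonian
cycles. -/
theorem sum_hamCount_insert_hamCycle_odd [Fintype V] [DecidableEq V]
    (E D : Finset (Sym2 V)) (hE : ∀ e ∈ E, ¬ e.IsDiag)
    (hD : IsHamiltonianCycleOn D) (hDE : Disjoint D E) :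
    (∑ S ∈ D.powerset, hamCount (E ∪ S)) ≡ 1 [MOD 2] := by
  set H := (E ∪ D).powerset.filter fun C => IsHamiltonianCycleOn C with hH
  have hcount : ∀ S ∈ D.powerset, hamCount (E ∪ S) = (H.filter fun C => C ⊆ E ∪ S).card := by
    intro S hS
    unfold hamCount
    congr 1
    ext C
    simp only [hH, Finset.mem_filter, Finset.mem_powerset] at hS ⊢
    exact ⟨fun h => ⟨⟨h.1.trans (Finset.union_subset_union_right hS), h.2⟩, h.1⟩,
      fun h => ⟨h.2, h.1.2⟩⟩
  have hswap : ∑ S ∈ D.powerset, hamCount (E ∪ S) =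
      ∑ C ∈ H, (D.powerset.filter fun S => C ⊆ E ∪ S).card := by
    rw [Finset.sum_congr rfl hcount]
    exact Finset.sum_card_bipartiteAbove_eq_sum_card_bipartiteBelow fun S C => C ⊆ E ∪ S
  have hDH : D ∈ H :=
    Finset.mem_filter.mpr ⟨Finset.mem_powerset.mpr Finset.subset_union_right, hD⟩
  have hone : (D.powerset.filter fun S => D ⊆ E ∪ S) = {D} := by
    ext S
    simp only [Finset.mem_filter, Finset.mem_powerset, Finset.mem_singleton]
    refine ⟨fun h => h.1.antisymm (hDE.left_le_of_le_sup_left h.2), ?_⟩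
    rintro rfl
    exact ⟨subset_rfl, Finset.subset_union_right⟩
  have heven : Even (∑ C ∈ H.erase D, (D.powerset.filter fun S => C ⊆ E ∪ S).card) := by
    refine Finset.even_sum _ fun C hC => ?_
    simp only [hH, Finset.mem_erase, Finset.mem_filter, Finset.mem_powerset] at hC
    exact even_card_filter_subset_union hC.2.1 fun h => hC.1 (hD.eq_of_subset hC.2.2 h)
  rw [hswap, ← Finset.add_sum_erase _ _ hDH, hone, Finset.card_singleton]
  exact Nat.odd_iff.mp (odd_one.add_even heven)
end
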